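/- Let δ > 0 and let b0, b1, b2, b3 : {v : 0 < |v| < δ} → ℝ be functions such that for every v in the domain: N(v, b0(v), b1(v), b2(v), b3(v)) = 0, (∂N/∂v)(v, b0(v), b1(v), b2(v), b3(v)) = 0, b0(v) = -95/6 + 16·b3(v) + 6·b2(v), and b1(v) = 125/12 - 9·b3(v) - 4·b2(v). Then as v → 0 with v ≠ 0: b0(v) → -12629/3024, b1(v) → 20483/4032, b2(v) → -3937/2016, and b3(v) → 17671/12096, i.e. the coefficients of the method with zero phase-lag and zero first derivative of the phase-lag tend to the classical Quinlan–Tremaine coefficients. -/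

import Mathlib

/-- Phase-lag numerator of the symmetric 8-step method. -/
noncomputable def N (v b0 b1 b2 b3 : ℝ) : ℝ :=
  16 * Real.cos v ^ 4 + (8 * b3 * v ^ 2 - 16) * Real.cos v ^ 3
    + (4 * b2 * v ^ 2 - 8) * Real.cos v ^ 2
    + (10 + (2 * b1 - 6 * b3) * v ^ 2) * Real.cos v - 2
    + (b0 - 2 * b2) * v ^ 2

open Filter Topology

/-- Normalized remainder of the sixth-order Taylor polynomial of `cos` at `0`. -/
noncomputable def cosRem (x : ℝ) : ℝ :=
  (Real.cos x - (1 - x ^ 2 / 2 + x ^ 4 / 24 - x ^ 6 / 720)) / x ^ 8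

/-- Normalized remainder of the fifth-order Taylor polynomial of `sin` at `0`. -/
noncomputable def sinRem (x : ℝ) : ℝ :=
  (Real.sin x - (x - x ^ 3 / 6 + x ^ 5 / 120)) / x ^ 7

lemma cos_eq_taylor_add_cosRem {x : ℝ} (hx : x ≠ 0) :
    Real.cos x = 1 - x ^ 2 / 2 + x ^ 4 / 24 - x ^ 6 / 720 + x ^ 8 * cosRem x := by
  unfold cosRem
  field_simp
  ring

lemma sin_eq_taylor_add_sinRem {x : ℝ} (hx : x ≠ 0) :
    Real.sin x = x - x ^ 3 / 6 + x ^ 5 / 120 + x ^ 7 * sinRem x := by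
  unfold sinRem
  field_simp
  ring

/-- Taylor bound for `exp (x * I)`, of which the real and imaginary parts bound `cos` and `sin`. -/
lemma norm_exp_mul_I_sub_taylor_le {x : ℝ} (hx : |x| ≤ 1) :
    ‖Complex.exp (x * Complex.I) -
      (((1 - x ^ 2 / 2 + x ^ 4 / 24 - x ^ 6 / 720 + x ^ 8 / 40320 : ℝ) : ℂ) +
        ((x - x ^ 3 / 6 + x ^ 5 / 120 - x ^ 7 / 5040 : ℝ) : ℂ) * Complex.I)‖ ≤ |x| ^ 9 := by
  have hz : ‖(x : ℂ) * Complex.I‖ = |x| := by simp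
  have h := Complex.exp_bound (x := x * Complex.I) (by rw [hz]; exact hx) (n := 9) (by norm_num)
  have hI4 : Complex.I ^ 4 = 1 := Complex.I_pow_four
  have hsum : ∑ m ∈ Finset.range 9, ((x : ℂ) * Complex.I) ^ m / (m.factorial : ℂ) =
      ((1 - x ^ 2 / 2 + x ^ 4 / 24 - x ^ 6 / 720 + x ^ 8 / 40320 : ℝ) : ℂ) +
        ((x - x ^ 3 / 6 + x ^ 5 / 120 - x ^ 7 / 5040 : ℝ) : ℂ) * Complex.I := by
    have h2 : Complex.I ^ 2 = -1 := Complex.I_sq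
    have h3 : Complex.I ^ 3 = -Complex.I := Complex.I_pow_three
    have h5 : Complex.I ^ 5 = Complex.I := by rw [pow_succ, hI4, one_mul]
    have h6 : Complex.I ^ 6 = -1 := by rw [pow_succ, h5, ← sq, h2]
    have h7 : Complex.I ^ 7 = -Complex.I := by rw [pow_succ, h6, neg_one_mul]
    have h8 : Complex.I ^ 8 = 1 := by rw [pow_succ, h7, neg_mul, ← sq, h2, neg_neg]
    simp only [Finset.sum_range_succ, Finset.sum_range_zero, Nat.factorial, mul_pow, h2, h3, hI4,
      h5, h6, h7, h8]
    push_cast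
    ring
  rw [hsum, hz] at h
  refine h.trans (mul_le_of_le_one_right (by positivity) ?_)
  norm_num [Nat.factorial]

lemma abs_cosRem_sub_le {x : ℝ} (hx0 : x ≠ 0) (hx : |x| ≤ 1) :
    |cosRem x - 1 / 40320| ≤ |x| := by
  have h := (Complex.abs_re_le_norm _).trans (norm_exp_mul_I_sub_taylor_le hx)
  simp only [Complex.sub_re, Complex.add_re, Complex.exp_ofReal_mul_I_re, Complex.ofReal_re,
    Complex.re_ofReal_mul, Complex.I_re, mul_zero, add_zero] at h
  rw [cos_eq_taylor_add_cosRem hx0, show ∀ r : ℝ, 1 - x ^ 2 / 2 + x ^ 4 / 24 - x ^ 6 / 720 +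
    x ^ 8 * r - (1 - x ^ 2 / 2 + x ^ 4 / 24 - x ^ 6 / 720 + x ^ 8 / 40320) =
    x ^ 8 * (r - 1 / 40320) from fun r => by ring, abs_mul, abs_pow, pow_succ] at h
  exact le_of_mul_le_mul_left h (by positivity)

lemma abs_sinRem_add_le {x : ℝ} (hx0 : x ≠ 0) (hx : |x| ≤ 1) :
    |sinRem x + 1 / 5040| ≤ |x| ^ 2 := by
  have h := (Complex.abs_im_le_norm _).trans (norm_exp_mul_I_sub_taylor_le hx)
  simp only [Complex.sub_im, Complex.add_im, Complex.exp_ofReal_mul_I_im, Complex.ofReal_im,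
    Complex.im_ofReal_mul, Complex.I_im, mul_one, zero_add] at h
  rw [sin_eq_taylor_add_sinRem hx0, show ∀ r : ℝ, x - x ^ 3 / 6 + x ^ 5 / 120 + x ^ 7 * r -
    (x - x ^ 3 / 6 + x ^ 5 / 120 - x ^ 7 / 5040) = x ^ 7 * (r + 1 / 5040) from
    fun r => by ring, abs_mul, abs_pow, show 9 = 7 + 2 from rfl, pow_add] at h
  exact le_of_mul_le_mul_left h (by positivity)

lemma eventually_punctured_abs_le_one : ∀ᶠ x : ℝ in 𝓝[≠] 0, x ≠ 0 ∧ |x| ≤ 1 := by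
  refine eventually_mem_nhdsWithin.and (eventually_nhdsWithin_of_eventually_nhds ?_)
  filter_upwards [Metric.ball_mem_nhds (0 : ℝ) one_pos] with x hx
  simpa using (mem_ball_zero_iff.mp hx).le

lemma tendsto_cosRem : Tendsto cosRem (𝓝[≠] 0) (𝓝 (1 / 40320)) := by
  rw [tendsto_iff_norm_sub_tendsto_zero]
  refine squeeze_zero' (.of_forall fun _ => norm_nonneg _)
    (eventually_punctured_abs_le_one.mono fun x hx => abs_cosRem_sub_le hx.1 hx.2) ?_
  exact tendsto_nhdsWithin_of_tendsto_nhds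
    (Continuous.tendsto' (by fun_prop) _ _ (by simp))

lemma tendsto_sinRem : Tendsto sinRem (𝓝[≠] 0) (𝓝 (-1 / 5040)) := by
  rw [tendsto_iff_norm_sub_tendsto_zero]
  refine squeeze_zero' (.of_forall fun _ => norm_nonneg _)
    (eventually_punctured_abs_le_one.mono fun x hx => ?_) (g := fun x => |x| ^ 2) ?_
  · rw [neg_div, sub_neg_eq_add]
    exact abs_sinRem_add_le hx.1 hx.2
  · exact tendsto_nhdsWithin_of_tendsto_nhds
      (Continuous.tendsto' (by fun_prop) _ _ (by simp))

lemma tendsto_const_mul_punctured_nhds_zero {k : ℝ} (hk : k ≠ 0) :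
    Tendsto (fun x : ℝ => k * x) (𝓝[≠] 0) (𝓝[≠] 0) := by
  refine tendsto_nhdsWithin_of_tendsto_nhds_of_eventually_within _
    (tendsto_nhdsWithin_of_tendsto_nhds (Continuous.tendsto' (by fun_prop) _ _ (by simp))) ?_
  filter_upwards [eventually_mem_nhdsWithin] with x hx
  exact mul_ne_zero hk hx

/-- The phase-lag numerator in multiple angles, on the affine family of coefficients of the
method. -/
lemma N_eq_multiple_angle (w b2 b3 : ℝ) :
    N w (-95 / 6 + 16 * b3 + 6 * b2) (125 / 12 - 9 * b3 - 4 * b2) b2 b3 =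
      2 * Real.cos (4 * w) - 4 * Real.cos (3 * w) + 4 * Real.cos (2 * w) - 2 * Real.cos w +
        w ^ 2 * (125 / 6 * Real.cos w - 95 / 6) +
        4 * w ^ 2 * (1 - Real.cos w) ^ 2 * (b2 + 2 * b3 * (Real.cos w + 2)) := by
  rw [N, show 4 * w = 2 * (2 * w) by ring, Real.cos_two_mul (2 * w), Real.cos_two_mul,
    Real.cos_three_mul]
  ring

lemma deriv_N_eq (v b2 b3 : ℝ) :
    deriv (fun w => N w (-95 / 6 + 16 * b3 + 6 * b2) (125 / 12 - 9 * b3 - 4 * b2) b2 b3) v =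
      -8 * Real.sin (4 * v) + 12 * Real.sin (3 * v) - 8 * Real.sin (2 * v) + 2 * Real.sin v +
        2 * v * (125 / 6 * Real.cos v - 95 / 6) - 125 / 6 * v ^ 2 * Real.sin v +
        (8 * v * (1 - Real.cos v) ^ 2 + 8 * v ^ 2 * (1 - Real.cos v) * Real.sin v) *
          (b2 + 2 * b3 * (Real.cos v + 2)) -
        8 * v ^ 2 * (1 - Real.cos v) ^ 2 * b3 * Real.sin v := by
  simp only [N_eq_multiple_angle]
  have hc := Real.hasDerivAt_cos v
  have hk (k : ℝ) : HasDerivAt (fun w => Real.cos (k * w)) (-Real.sin (k * v) * (k * 1)) v :=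
    ((hasDerivAt_id v).const_mul k).cos
  have hsq : HasDerivAt (fun w : ℝ => w ^ 2) (2 * v) v := by simpa using hasDerivAt_pow 2 v
  have h := ((((((hk 4).const_mul 2).sub ((hk 3).const_mul 4)).add ((hk 2).const_mul 4)).sub
    (hc.const_mul 2)).add (hsq.mul ((hc.const_mul (125 / 6)).sub_const (95 / 6)))).add
    (((hsq.const_mul 4).mul ((hc.const_sub 1).pow 2)).mul
      (((hc.add_const 2).const_mul (2 * b3)).const_add b2))
  refine (HasDerivAt.congr_deriv h ?_).deriv
  simp only [Pi.mul_apply, Pi.pow_apply]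
  push_cast
  ring

/-- `(1 - cos v) / v ^ 2` -/
noncomputable def versinQuot (v : ℝ) : ℝ :=
  1 / 2 - v ^ 2 / 24 + v ^ 4 / 720 - v ^ 6 * cosRem v

/-- `sin v / v` -/
noncomputable def sinQuot (v : ℝ) : ℝ :=
  1 - v ^ 2 / 6 + v ^ 4 / 120 + v ^ 6 * sinRem v

/-- The part of order `v ^ 8` of the coefficient-free part of the phase-lag numerator. -/
noncomputable def valueRem (v : ℝ) : ℝ :=
  2 * 4 ^ 8 * cosRem (4 * v) - 4 * 3 ^ 8 * cosRem (3 * v) + 4 * 2 ^ 8 * cosRem (2 * v) -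
    2 * cosRem v + 125 / 6 * (-1 / 720 + v ^ 2 * cosRem v)

/-- The part of order `v ^ 7` of the derivative of the coefficient-free part of the phase-lag
numerator. -/
noncomputable def derivRem (v : ℝ) : ℝ :=
  -8 * 4 ^ 7 * sinRem (4 * v) + 12 * 3 ^ 7 * sinRem (3 * v) - 8 * 2 ^ 7 * sinRem (2 * v) +
    2 * sinRem v + 125 / 3 * (-1 / 720 + v ^ 2 * cosRem v) -
    125 / 6 * (1 / 120 + v ^ 2 * sinRem v)

/-- The quotient of `versinQuot v * A' - 2 * (versinQuot v + sinQuot v) * A` by `v ^ 2`, where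
`A = -109 / 16 + v ^ 2 * valueRem v` and `A' = -327 / 8 + v ^ 2 * derivRem v`. -/
noncomputable def elimRem (v : ℝ) : ℝ :=
  -327 / 8 * (-1 / 24 + v ^ 2 / 720 - v ^ 4 * cosRem v) + versinQuot v * derivRem v +
    109 / 8 * (-1 / 24 + v ^ 2 / 720 - v ^ 4 * cosRem v - 1 / 6 + v ^ 2 / 120 +
      v ^ 4 * sinRem v) -
    2 * (versinQuot v + sinQuot v) * valueRem v

lemma one_sub_cos_eq {v : ℝ} (hv : v ≠ 0) : 1 - Real.cos v = v ^ 2 * versinQuot v := by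
  rw [cos_eq_taylor_add_cosRem hv, versinQuot]
  ring

lemma sin_eq_mul_sinQuot {v : ℝ} (hv : v ≠ 0) : Real.sin v = v * sinQuot v := by
  rw [sin_eq_taylor_add_sinRem hv, sinQuot]
  ring

lemma value_eq_of_N_eq_zero {v b2 b3 : ℝ} (hv : v ≠ 0)
    (h : N v (-95 / 6 + 16 * b3 + 6 * b2) (125 / 12 - 9 * b3 - 4 * b2) b2 b3 = 0) :
    -109 / 16 + v ^ 2 * valueRem v +
      4 * versinQuot v ^ 2 * (b2 + 2 * b3 * (Real.cos v + 2)) = 0 := by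
  rw [N_eq_multiple_angle, one_sub_cos_eq hv] at h
  generalize b2 + 2 * b3 * (Real.cos v + 2) = Q at h ⊢
  rw [cos_eq_taylor_add_cosRem hv,
    cos_eq_taylor_add_cosRem (mul_ne_zero two_ne_zero hv),
    cos_eq_taylor_add_cosRem (mul_ne_zero three_ne_zero hv),
    cos_eq_taylor_add_cosRem (mul_ne_zero four_ne_zero hv)] at h
  refine (mul_eq_zero.mp ?_).resolve_left (pow_ne_zero 6 hv)
  rw [valueRem]
  linear_combination h

lemma deriv_eq_of_deriv_N_eq_zero {v b2 b3 : ℝ} (hv : v ≠ 0)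
    (h : deriv (fun w => N w (-95 / 6 + 16 * b3 + 6 * b2) (125 / 12 - 9 * b3 - 4 * b2) b2 b3) v
      = 0) :
    -327 / 8 + v ^ 2 * derivRem v +
      8 * versinQuot v * (versinQuot v + sinQuot v) * (b2 + 2 * b3 * (Real.cos v + 2)) -
      8 * v ^ 2 * versinQuot v ^ 2 * sinQuot v * b3 = 0 := by
  rw [deriv_N_eq, one_sub_cos_eq hv] at h
  generalize b2 + 2 * b3 * (Real.cos v + 2) = Q at h ⊢
  have hs := sin_eq_mul_sinQuot hv
  rw [cos_eq_taylor_add_cosRem hv,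
    sin_eq_taylor_add_sinRem (mul_ne_zero two_ne_zero hv),
    sin_eq_taylor_add_sinRem (mul_ne_zero three_ne_zero hv),
    sin_eq_taylor_add_sinRem (mul_ne_zero four_ne_zero hv)] at h
  refine (mul_eq_zero.mp ?_).resolve_left (pow_ne_zero 5 hv)
  have hs' := sin_eq_taylor_add_sinRem hv
  rw [derivRem]
  linear_combination h + (8 * v ^ 6 * versinQuot v ^ 2 * b3 - 8 * v ^ 4 * versinQuot v * Q) * hs +
    (125 / 6 * v ^ 2 - 2) * hs'

lemma b3_mul_eq {v b2 b3 : ℝ} (hv : v ≠ 0)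
    (hN : N v (-95 / 6 + 16 * b3 + 6 * b2) (125 / 12 - 9 * b3 - 4 * b2) b2 b3 = 0)
    (hN' : deriv (fun w => N w (-95 / 6 + 16 * b3 + 6 * b2) (125 / 12 - 9 * b3 - 4 * b2) b2 b3) v
      = 0) :
    b3 * (8 * versinQuot v ^ 3 * sinQuot v) = elimRem v := by
  have h1 := value_eq_of_N_eq_zero hv hN
  have h2 := deriv_eq_of_deriv_N_eq_zero hv hN'
  have hE : versinQuot v * (-327 / 8 + v ^ 2 * derivRem v) -
      2 * (versinQuot v + sinQuot v) * (-109 / 16 + v ^ 2 * valueRem v) =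
      v ^ 2 * elimRem v := by
    rw [elimRem, versinQuot, sinQuot]
    ring
  refine mul_left_cancel₀ (pow_ne_zero 2 hv) ?_
  linear_combination 2 * (versinQuot v + sinQuot v) * h1 - versinQuot v * h2 + hE

/-- The coefficients of the method with zero phase-lag and zero first
derivative of the phase-lag tend to the classical Quinlan–Tremaine
coefficients as `v → 0`, `v ≠ 0`. -/
theorem coeffs_zero_PL_PL'_tendsto_classical
    (δ : ℝ) (hδ : 0 < δ) (b0 b1 b2 b3 : ℝ → ℝ)
    (hcond : ∀ v : ℝ, 0 < |v| → |v| < δ →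
      N v (b0 v) (b1 v) (b2 v) (b3 v) = 0 ∧
      deriv (fun w => N w (b0 v) (b1 v) (b2 v) (b3 v)) v = 0 ∧
      b0 v = -95 / 6 + 16 * b3 v + 6 * b2 v ∧
      b1 v = 125 / 12 - 9 * b3 v - 4 * b2 v) :
    Filter.Tendsto b0 (nhdsWithin 0 {(0 : ℝ)}ᶜ) (nhds (-12629 / 3024)) ∧
    Filter.Tendsto b1 (nhdsWithin 0 {(0 : ℝ)}ᶜ) (nhds (20483 / 4032)) ∧
    Filter.Tendsto b2 (nhdsWithin 0 {(0 : ℝ)}ᶜ) (nhds (-3937 / 2016)) ∧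
    Filter.Tendsto b3 (nhdsWithin 0 {(0 : ℝ)}ᶜ) (nhds (17671 / 12096)) := by
  have hv : Tendsto (fun v : ℝ => v) (𝓝[≠] 0) (𝓝 0) := tendsto_id.mono_left nhdsWithin_le_nhds
  have hc := tendsto_cosRem
  have hs := tendsto_sinRem
  have hck {k : ℝ} (hk : k ≠ 0) :=
    tendsto_cosRem.comp (tendsto_const_mul_punctured_nhds_zero hk)
  have hsk {k : ℝ} (hk : k ≠ 0) :=
    tendsto_sinRem.comp (tendsto_const_mul_punctured_nhds_zero hk)
  have hcos : Tendsto Real.cos (𝓝[≠] 0) (𝓝 1) :=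
    tendsto_nhdsWithin_of_tendsto_nhds (Real.continuous_cos.tendsto' _ _ Real.cos_zero)
  have hU : Tendsto versinQuot (𝓝[≠] 0) (𝓝 (1 / 2)) := by
    have h : Tendsto versinQuot (𝓝[≠] 0) (𝓝 _) :=
      (((hv.pow 2).div_const 24).const_sub (1 / 2)).add ((hv.pow 4).div_const 720) |>.sub
      ((hv.pow 6).mul hc)
    convert h using 2
    norm_num
  have hS : Tendsto sinQuot (𝓝[≠] 0) (𝓝 1) := by
    have h : Tendsto sinQuot (𝓝[≠] 0) (𝓝 _) :=
      (((hv.pow 2).div_const 6).const_sub 1).add ((hv.pow 4).div_const 120) |>.add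
      ((hv.pow 6).mul hs)
    convert h using 2
    norm_num
  have hE : Tendsto valueRem (𝓝[≠] 0) (𝓝 (2 * 4 ^ 8 * (1 / 40320) - 4 * 3 ^ 8 * (1 / 40320) +
      4 * 2 ^ 8 * (1 / 40320) - 2 * (1 / 40320) +
      125 / 6 * (-1 / 720 + 0 ^ 2 * (1 / 40320)))) :=
    (((((hck four_ne_zero).const_mul _).sub ((hck three_ne_zero).const_mul _)).add
      ((hck two_ne_zero).const_mul _)).sub (hc.const_mul _)).add
      ((((hv.pow 2).mul hc).const_add _).const_mul _)
  have hD : Tendsto derivRem (𝓝[≠] 0) (𝓝 (-8 * 4 ^ 7 * (-1 / 5040) + 12 * 3 ^ 7 * (-1 / 5040) -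
      8 * 2 ^ 7 * (-1 / 5040) + 2 * (-1 / 5040) +
      125 / 3 * (-1 / 720 + 0 ^ 2 * (1 / 40320)) -
      125 / 6 * (1 / 120 + 0 ^ 2 * (-1 / 5040)))) :=
    ((((((hsk four_ne_zero).const_mul _).add ((hsk three_ne_zero).const_mul _)).sub
      ((hsk two_ne_zero).const_mul _)).add (hs.const_mul _)).add
      ((((hv.pow 2).mul hc).const_add _).const_mul _)).sub
      ((((hv.pow 2).mul hs).const_add _).const_mul _)
  have hU1 := (((hv.pow 2).div_const 720).const_add (-1 / 24)).sub ((hv.pow 4).mul hc)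
  have hF : Tendsto elimRem (𝓝[≠] 0) (𝓝 (17671 / 12096)) := by
    have h : Tendsto elimRem (𝓝[≠] 0) (𝓝 _) :=
      (((hU1.const_mul (-327 / 8)).add (hU.mul hD)).add
      ((((hU1.sub_const (1 / 6)).add ((hv.pow 2).div_const 120)).add
        ((hv.pow 4).mul hs)).const_mul (109 / 8))).sub
      (((hU.add hS).const_mul 2).mul hE)
    convert h using 2
    norm_num
  have hP : Tendsto (fun v => 8 * versinQuot v ^ 3 * sinQuot v) (𝓝[≠] 0) (𝓝 1) := by
    convert ((hU.pow 3).const_mul 8).mul hS using 2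
    norm_num
  have hdom : ∀ᶠ v : ℝ in 𝓝[≠] 0, v ≠ 0 ∧ |v| < δ := by
    refine eventually_mem_nhdsWithin.and (eventually_nhdsWithin_of_eventually_nhds ?_)
    filter_upwards [Metric.ball_mem_nhds (0 : ℝ) hδ] with v hv
    simpa using hv
  have hb3 : Tendsto b3 (𝓝[≠] 0) (𝓝 (17671 / 12096)) := by
    have h := hF.div hP one_ne_zero
    rw [div_one] at h
    refine h.congr' ?_
    filter_upwards [hdom, hP.eventually_ne one_ne_zero] with v hv hPv
    obtain ⟨hN, hN', h0, h1⟩ := hcond v (abs_pos.mpr hv.1) hv.2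
    rw [h0, h1] at hN hN'
    exact (eq_div_of_mul_eq hPv (b3_mul_eq hv.1 hN hN')).symm
  have hb2 : Tendsto b2 (𝓝[≠] 0) (𝓝 (-3937 / 2016)) := by
    have h := ((((hv.pow 2).mul hE).const_add (-109 / 16)).neg.div ((hU.pow 2).const_mul 4)
      (by norm_num)).sub ((hb3.const_mul 2).mul (hcos.add_const 2))
    convert h.congr' ?_ using 2
    · norm_num
    filter_upwards [hdom, hU.eventually_ne one_half_pos.ne'] with v hv hUv
    obtain ⟨hN, -, h0, h1⟩ := hcond v (abs_pos.mpr hv.1) hv.2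
    rw [h0, h1] at hN
    have hA := value_eq_of_N_eq_zero hv.1 hN
    simp only [Pi.div_apply]
    rw [sub_eq_iff_eq_add, div_eq_iff (mul_ne_zero four_ne_zero (pow_ne_zero 2 hUv))]
    linear_combination -hA
  refine ⟨?_, ?_, hb2, hb3⟩
  · have h := ((hb3.const_mul 16).const_add (-95 / 6)).add (hb2.const_mul 6)
    convert h.congr' ?_ using 2
    · norm_num
    filter_upwards [hdom] with v hv
    exact (hcond v (abs_pos.mpr hv.1) hv.2).2.2.1.symm
  · have h := ((hb3.const_mul 9).const_sub (125 / 12)).sub (hb2.const_mul 4)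
    convert h.congr' ?_ using 2
    · norm_num
    filter_upwards [hdom] with v hv
    exact (hcond v (abs_pos.mpr hv.1) hv.2).2.2.2.symm
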